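/- For any even positive integer K, the quadratic Gauss sum with halved exponents evaluates as: the sum over n from 0 to K-1 of exp(πi n²/K) equals exp(πi/4)·√K. -/

import Mathlib

set_option autoImplicit false
open Complex Filter Topology

noncomputable def gT (a : ℂ) : ℂ := ∑' n : ℤ, cexp (-Real.pi * a * (n : ℂ) ^ 2)

lemma gT_eq_theta (a : ℂ) : gT a = jacobiTheta (I * a) := by
  unfold gT jacobiTheta
  refine tsum_congr fun n => ?_
  congr 1
  linear_combination (-Real.pi * a * (n:ℂ)^2) * I_sq

lemma gT_summable {a : ℂ} (ha : 0 < a.re) :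
    Summable (fun n : ℤ => cexp (-Real.pi * a * (n : ℂ) ^ 2)) := by
  have h := (hasSum_jacobiTheta₂_term 0 (τ := I * a) (by simpa using ha)).summable
  refine h.congr fun n => ?_
  unfold jacobiTheta₂_term
  congr 1
  linear_combination (-Real.pi * a * (n:ℂ)^2) * I_sq * (-1)

lemma gT_inv {a : ℂ} (ha : 0 < a.re) : gT a = 1 / a ^ (1 / 2 : ℂ) * gT (1 / a) := by
  unfold gT
  rw [Complex.tsum_exp_neg_mul_int_sq ha]
  congr 1
  refine tsum_congr fun n => ?_
  congr 1
  ring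

lemma gT_shift (a : ℂ) (K : ℕ) (hKe : Even K) : gT (a + I * K) = gT a := by
  obtain ⟨k, rfl⟩ := hKe
  unfold gT
  refine tsum_congr fun n => ?_
  rw [Complex.exp_eq_exp_iff_exists_int]
  refine ⟨-(k * n ^ 2), ?_⟩
  push_cast
  ring

lemma gT_tendsto (c : ℝ) : Tendsto (fun y : ℝ => gT (y + I * c)) atTop (𝓝 1) := by
  have h := isBigO_at_im_infty_jacobiTheta_sub_one
  have h1 : Tendsto (fun y : ℝ => I * ((y:ℂ) + I * c)) atTop (comap im atTop) := by
    rw [tendsto_comap_iff]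
    have : im ∘ (fun y : ℝ => I * ((y:ℂ) + I * c)) = id := by ext y; simp
    rw [this]
    exact tendsto_id
  have h2 := h.comp_tendsto h1
  have h3 : Tendsto ((fun τ : ℂ => Real.exp (-Real.pi * τ.im)) ∘
      (fun y : ℝ => I * ((y:ℂ) + I * c))) atTop (𝓝 0) := by
    have : ((fun τ : ℂ => Real.exp (-Real.pi * τ.im)) ∘
      (fun y : ℝ => I * ((y:ℂ) + I * c))) = fun y => Real.exp (-(Real.pi * y)) := by
      ext y; simp
    rw [this]
    exact Real.tendsto_exp_neg_atTop_nhds_zero.comp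
      (tendsto_id.const_mul_atTop Real.pi_pos)
  have h4 := (h2.trans_tendsto h3).add_const 1
  simpa [Function.comp_def, gT_eq_theta] using h4

lemma cosK_tendsto (a : UnitAddCircle) :
    Tendsto (fun y : ℝ => HurwitzZeta.cosKernel a y) atTop (𝓝 1) := by
  obtain ⟨p, hp, h⟩ := HurwitzZeta.isBigO_atTop_cosKernel_sub a
  have h3 : Tendsto (fun y : ℝ => Real.exp (-p * y)) atTop (𝓝 0) := by
    simpa [Function.comp_def] using Real.tendsto_exp_neg_atTop_nhds_zero.comp
      (tendsto_id.const_mul_atTop hp)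
  simpa using (h.trans_tendsto h3).add_const 1

lemma gT_split (K : ℕ) (hK : 0 < K) (hKe : Even K) (t : ℝ) (ht : 0 < t) :
    gT (t / K ^ 2 - I / K) = ∑ r ∈ Finset.range K,
      cexp ((Real.pi : ℂ) * I * (r : ℂ) ^ 2 / (K : ℂ)) *
        (HurwitzZeta.evenKernel ((r / K : ℝ) : UnitAddCircle) t : ℂ) := by
  have hK0 : (K : ℂ) ≠ 0 := by exact_mod_cast hK.ne'
  have : NeZero K := ⟨hK.ne'⟩
  have hre : 0 < ((t:ℂ) / K ^ 2 - I / K).re := by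
    have : ((t:ℂ) / K ^ 2 - I / K) = ((t / K^2 : ℝ) : ℂ) - ((1 / K : ℝ) : ℂ) * I := by
      push_cast; ring
    rw [this, sub_re, ofReal_re, re_ofReal_mul, I_re, mul_zero, sub_zero]; positivity
  have hs := gT_summable hre
  unfold gT
  let e := (Equiv.prodComm (Fin K) ℤ).trans (Int.divModEquiv K).symm
  rw [← e.tsum_eq]
  change ∑' p, ((fun n : ℤ => cexp (-Real.pi * ((t:ℂ) / K ^ 2 - I / K) * (n : ℂ) ^ 2)) ∘ e) p = _
  rw [((e.summable_iff (f := fun n : ℤ =>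
    cexp (-Real.pi * ((t:ℂ) / K ^ 2 - I / K) * (n : ℂ) ^ 2))).2 hs).tsum_prod, tsum_fintype,
    ← Fin.sum_univ_eq_sum_range (fun r : ℕ => cexp ((Real.pi : ℂ) * I * (r : ℂ) ^ 2 / (K : ℂ)) *
        (HurwitzZeta.evenKernel ((r / K : ℝ) : UnitAddCircle) t : ℂ))]
  refine Finset.sum_congr rfl fun r _ => ?_
  rw [← (HurwitzZeta.hasSum_int_evenKernel (r / K : ℝ) ht).tsum_eq, ofReal_tsum, ← tsum_mul_left]
  refine tsum_congr fun m => ?_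
  have he : ((e (r, m) : ℤ) : ℂ) = r + K * m := by
    simp [e, Int.divModEquiv]
    try ring
  obtain ⟨k, hk⟩ := hKe
  have hk' : (K:ℂ) = k + k := by exact_mod_cast hk
  simp only [Function.comp_apply, he]
  rw [ofReal_exp, ← Complex.exp_add, Complex.exp_eq_exp_iff_exists_int]
  refine ⟨r * m + k * m ^ 2, ?_⟩
  push_cast
  field_simp
  linear_combination ((K:ℂ) ^ 2 * (m:ℂ) ^ 2 * I) * hk'

lemma key (K : ℕ) (hK : 0 < K) (hKe : Even K) (y : ℝ) (hy : 0 < y) :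
    ∑ r ∈ Finset.range K, cexp ((Real.pi : ℂ) * I * (r : ℂ) ^ 2 / (K : ℂ)) *
        (HurwitzZeta.cosKernel ((r / K : ℝ) : UnitAddCircle) y : ℂ) =
    1 / (((y:ℂ)⁻¹ / K ^ 2 - I / K : ℂ) ^ (1/2 : ℂ) * ((1 / (1 + I / K * (y:ℂ)⁻¹) : ℂ) ^ (1/2 : ℂ)))
      * gT (y + I * (1 / K : ℝ)) := by
  have hK0 : (K : ℂ) ≠ 0 := by exact_mod_cast hK.ne'
  have hKr : (0 : ℝ) < K := by exact_mod_cast hK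
  have hy0 : (y : ℂ) ≠ 0 := by exact_mod_cast hy.ne'
  have h1 := gT_split K hK hKe y⁻¹ (inv_pos.2 hy)
  simp only [HurwitzZeta.evenKernel_functional_equation, ofReal_mul] at h1
  set a : ℂ := ((y⁻¹ : ℝ) : ℂ) / K ^ 2 - I / K with ha
  set b : ℂ := y + I * (1 / K : ℝ) with hb
  have hare : 0 < a.re := by
    have : a = ((y⁻¹ / K^2 : ℝ) : ℂ) - ((1 / K : ℝ) : ℂ) * I := by
      rw [ha]; push_cast; ring
    rw [this, sub_re, ofReal_re, re_ofReal_mul, I_re, mul_zero, sub_zero]; positivity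
  have hbre : 0 < b.re := by rw [hb]; simpa using hy
  have ha0 : a ≠ 0 := by rintro h; simp [h] at hare
  have hb0 : b ≠ 0 := by rintro h; simp [h] at hbre
  have hwre : 0 < (1 / b).re := by
    rw [one_div, inv_re]; exact div_pos hbre (normSq_pos.2 hb0)
  have hab : 1 / a = 1 / b + I * K := by
    have : I * K * a * b = b - a := by
      rw [ha, hb]; push_cast; field_simp
      ring_nf
      simp [I_sq]
      try ring
    field_simp
    linear_combination -this
  rw [gT_inv hare, hab, gT_shift _ K hKe, gT_inv hwre, one_div_one_div] at h1
  have hpow : (1 / (1 + I / K * (y:ℂ)⁻¹) : ℂ) ^ (1/2 : ℂ) =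
      ((y ^ (1/2 : ℝ) : ℝ) : ℂ) * (1 / b) ^ (1/2:ℂ) := by
    have e1 : (1 / (1 + I / K * (y:ℂ)⁻¹) : ℂ) = y * (1 / b) := by
      have : b = y * (1 + I / K * (y:ℂ)⁻¹) := by
        rw [hb]; push_cast; field_simp
      rw [this]
      have h0 : (1 + I / K * (y:ℂ)⁻¹) ≠ 0 := by
        rintro h; rw [h] at this; simp [this] at hb0
      field_simp
    rw [e1, cpow_def_of_ne_zero (by simp [hy0, hb0]), log_ofReal_mul hy (by simp [hb0]), add_mul,
      Complex.exp_add, cpow_def_of_ne_zero (x := 1 / b) (by simp [hb0]), Real.rpow_def_of_pos hy]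
    push_cast
    rfl
  have hy12 : ((y ^ (1/2 : ℝ) : ℝ) : ℂ) ≠ 0 := by
    exact_mod_cast (Real.rpow_pos_of_pos hy _).ne'
  have hz : (((1 / y⁻¹ ^ (1/2:ℝ) : ℝ)) : ℂ) = ((y ^ (1/2 : ℝ) : ℝ) : ℂ) := by
    rw [Real.inv_rpow hy.le, one_div, inv_inv]
  simp only [hz] at h1
  simp only [one_div, inv_inv] at h1
  have ha' : (y:ℂ)⁻¹ / K ^ 2 - I / K = a := by rw [ha]; push_cast; rfl
  rw [hpow, ha']
  simp only [one_div]
  have : ∑ r ∈ Finset.range K, cexp ((Real.pi : ℂ) * I * (r : ℂ) ^ 2 / (K : ℂ)) *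
        (((y ^ (2⁻¹ : ℝ) : ℝ) : ℂ) *
        (HurwitzZeta.cosKernel ((r / K : ℝ) : UnitAddCircle) y : ℂ)) =
      ((y ^ (2⁻¹ : ℝ) : ℝ) : ℂ) *
      ∑ r ∈ Finset.range K, cexp ((Real.pi : ℂ) * I * (r : ℂ) ^ 2 / (K : ℂ)) *
        (HurwitzZeta.cosKernel ((r / K : ℝ) : UnitAddCircle) y : ℂ) := by
    rw [Finset.mul_sum]; refine Finset.sum_congr rfl fun r _ => by ring
  rw [this] at h1
  simp only [one_div] at hy12
  apply mul_left_cancel₀ hy12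
  rw [← h1, mul_inv, mul_inv]
  linear_combination (-((a ^ (2⁻¹ : ℂ))⁻¹ * ((b⁻¹ ^ (2⁻¹ : ℂ))⁻¹ * gT b))) * mul_inv_cancel₀ hy12

theorem gauss_sum_halved_exponents (K : ℕ) (hK : 0 < K) (hKe : Even K) :
    ∑ n ∈ Finset.range K,
        Complex.exp ((Real.pi : ℂ) * Complex.I * (n : ℂ) ^ 2 / (K : ℂ)) =
      Complex.exp ((Real.pi : ℂ) * Complex.I / 4) * (Real.sqrt K : ℂ) := by
  have hKr : (0 : ℝ) < K := by exact_mod_cast hK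
  have hK0 : (K : ℂ) ≠ 0 := by exact_mod_cast hK.ne'
  have L : Tendsto (fun y : ℝ => ∑ r ∈ Finset.range K,
      cexp ((Real.pi : ℂ) * I * (r : ℂ) ^ 2 / (K : ℂ)) *
        (HurwitzZeta.cosKernel ((r / K : ℝ) : UnitAddCircle) y : ℂ)) atTop
      (𝓝 (∑ r ∈ Finset.range K, cexp ((Real.pi : ℂ) * I * (r : ℂ) ^ 2 / (K : ℂ)) *
        ((1 : ℝ) : ℂ))) := by
    refine tendsto_finsetSum _ fun r _ => ?_
    exact ((continuous_ofReal.tendsto 1).comp (cosK_tendsto _)).const_mul _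
  have hinv : Tendsto (fun y : ℝ => (y : ℂ)⁻¹) atTop (𝓝 0) := by
    have := (continuous_ofReal.tendsto 0).comp tendsto_inv_atTop_zero
    simpa [Function.comp_def] using this
  have hc : ContinuousAt (fun z : ℂ => 1 / ((z / K ^ 2 - I / K : ℂ) ^ (1/2 : ℂ) *
      ((1 / (1 + I / K * z) : ℂ) ^ (1/2 : ℂ)))) 0 := by
    have i1 : (0 / (K:ℂ) ^ 2 - I / K : ℂ) ≠ 0 := by simp [hK0]
    have s1 : (0 / (K:ℂ) ^ 2 - I / K : ℂ) ∈ slitPlane := by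
      right
      have : (0 / (K:ℂ) ^ 2 - I / K : ℂ) = ((-(1 / K) : ℝ) : ℂ) * I := by push_cast; ring
      rw [this]; simp [hK.ne']
    refine ContinuousAt.div continuousAt_const (.mul (.cpow ?_ continuousAt_const s1)
      (.cpow (.div continuousAt_const ?_ ?_) continuousAt_const ?_)) ?_
    · fun_prop
    · fun_prop
    · simp
    · simp
    · refine mul_ne_zero ?_ ?_
      · rw [Ne, cpow_eq_zero_iff]; exact fun h => i1 h.1
      · simp
  have R := (hc.tendsto.comp hinv).mul (gT_tendsto (1 / K))
  have hE := tendsto_nhds_unique (L.congr' (by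
    filter_upwards [eventually_gt_atTop 0] with y hy
    exact key K hK hKe y hy)) R
  simp only [ofReal_one, mul_one] at hE
  rw [hE]
  have : (0 / (K:ℂ) ^ 2 - I / K : ℂ) = ((1 / K : ℝ) : ℂ) * (-I) := by push_cast; ring
  rw [this, cpow_def_of_ne_zero (by simp [hK0]),
    log_ofReal_mul (by positivity) (by simp), log_neg_I]
  simp only [mul_zero, add_zero, div_one, one_cpow, mul_one]
  rw [one_div, ← Complex.exp_neg, Real.sqrt_eq_rpow, Real.rpow_def_of_pos hKr, ofReal_exp,
    ← Complex.exp_add]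
  congr 1
  rw [one_div, Real.log_inv]
  push_cast
  ring
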